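/- arXiv:1704.01368 — 2 statements merged into one kernel-verified Lean document; each statement's English description precedes it below -/
import Mathlib

section
/- Fix real parameters ω > 0, χ > 0, ζ > 0, C > 0 and set γ = ωχ, μ = γC. Define F₂(P) = −χP² + γP + μ − ζP²e^{ω/P} for P > 0, and let β > 0 be the unique zero of F₂′(P) = −2χP + γ + ζ e^{ω/P}(ω − 2P). If F₂(β) > 0, then there exist unique α₁, α₂ with 0 < α₁ < β < α₂ such that F₂(α₁) = F₂(α₂) = 0; moreover F₂(P) < 0 for P ∈ (0, α₁), F₂(P) > 0 for P ∈ (α₁, α₂), and F₂(P) < 0 for P ∈ (α₂, ∞). -/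
/-- The auxiliary function `F₂(P) = -χ P² + γ P + μ - ζ P² e^{ω/P}`. -/
noncomputable def F2 (ω χ γ μ ζ : ℝ) (P : ℝ) : ℝ :=
  -χ * P ^ 2 + γ * P + μ - ζ * P ^ 2 * Real.exp (ω / P)

/-- `F₂'(P) = -2χP + γ + ζ e^{ω/P} (ω - 2P)`. -/
noncomputable def F2deriv (ω χ γ ζ : ℝ) (P : ℝ) : ℝ :=
  -2 * χ * P + γ + ζ * Real.exp (ω / P) * (ω - 2 * P)

theorem F2_hasDerivAt (ω χ γ μ ζ : ℝ) {P : ℝ} (hP : P ≠ 0) :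
    HasDerivAt (F2 ω χ γ μ ζ) (F2deriv ω χ γ ζ P) P := by
  have hexp : HasDerivAt (fun x : ℝ => Real.exp (ω / x))
      (Real.exp (ω / P) * ((0 * P - ω * 1) / P ^ 2)) P :=
    ((hasDerivAt_const P ω).div (hasDerivAt_id P) hP).exp
  have hsq : HasDerivAt (fun x : ℝ => x ^ 2) (2 * P) P := by
    simpa using hasDerivAt_pow 2 P
  have h := (((hsq.const_mul (-χ)).add ((hasDerivAt_id P).const_mul γ)).add_const μ).sub
    ((hsq.const_mul ζ).mul hexp)
  refine h.congr_deriv ?_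
  unfold F2deriv
  field_simp
  ring

theorem F2deriv_eq_mul (ω χ ζ P : ℝ) :
    F2deriv ω χ (ω * χ) ζ P = (χ + ζ * Real.exp (ω / P)) * (ω - 2 * P) := by
  unfold F2deriv
  ring

theorem F2_continuousOn (ω χ γ μ ζ : ℝ) : ContinuousOn (F2 ω χ γ μ ζ) (Set.Ioi 0) :=
  fun _ hx => (F2_hasDerivAt ω χ γ μ ζ (ne_of_gt hx)).continuousAt.continuousWithinAt

theorem F2_strictMonoOn {ω χ ζ : ℝ} (μ : ℝ) (hχ : 0 < χ) (hζ : 0 < ζ) :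
    StrictMonoOn (F2 ω χ (ω * χ) μ ζ) (Set.Ioc 0 (ω / 2)) := by
  refine strictMonoOn_of_deriv_pos (convex_Ioc _ _)
    ((F2_continuousOn _ _ _ _ _).mono fun x hx => hx.1) fun x hx => ?_
  rw [interior_Ioc] at hx
  rw [(F2_hasDerivAt _ _ _ _ _ hx.1.ne').deriv, F2deriv_eq_mul]
  exact mul_pos (by positivity) (by linarith [hx.2])

theorem F2_strictAntiOn {ω χ ζ : ℝ} (μ : ℝ) (hω : 0 < ω) (hχ : 0 < χ) (hζ : 0 < ζ) :
    StrictAntiOn (F2 ω χ (ω * χ) μ ζ) (Set.Ici (ω / 2)) := by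
  have hpos : ∀ x ∈ Set.Ici (ω / 2), 0 < x := fun x hx => (half_pos hω).trans_le hx
  refine strictAntiOn_of_deriv_neg (convex_Ici _)
    ((F2_continuousOn _ _ _ _ _).mono hpos) fun x hx => ?_
  have hx0 := hpos x (interior_subset hx)
  rw [interior_Ici, Set.mem_Ioi] at hx
  rw [(F2_hasDerivAt _ _ _ _ _ hx0.ne').deriv, F2deriv_eq_mul]
  exact mul_neg_of_pos_of_neg (by positivity) (by linarith)

/-- The exponential term forces `F2` to be negative somewhere near `0`. -/
theorem exists_F2_neg_le {ω χ γ μ ζ β : ℝ} (hω : 0 < ω) (hχ : 0 < χ) (hγ : 0 < γ)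
    (hμ : 0 < μ) (hζ : 0 < ζ) (hβ : 0 < β) :
    ∃ P, 0 < P ∧ P ≤ β ∧ F2 ω χ γ μ ζ P < 0 := by
  set M := γ * β + μ with hM
  have hM0 : 0 < M := by positivity
  have hK : 0 < ζ * ω ^ 3 / (6 * M) := by positivity
  refine ⟨min β (ζ * ω ^ 3 / (6 * M)), lt_min hβ hK, min_le_left _ _, ?_⟩
  generalize hPdef : min β (ζ * ω ^ 3 / (6 * M)) = P
  have hP : 0 < P := hPdef ▸ lt_min hβ hK
  have hPβ : P ≤ β := hPdef ▸ min_le_left _ _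
  have hPK : P ≤ ζ * ω ^ 3 / (6 * M) := hPdef ▸ min_le_right _ _
  have hexp : (ω / P) ^ 3 / 6 ≤ Real.exp (ω / P) := by
    simpa [Nat.factorial] using Real.pow_div_factorial_le_exp (ω / P) (by positivity) 3
  have hterm : M ≤ ζ * P ^ 2 * Real.exp (ω / P) := by
    calc M ≤ ζ * ω ^ 3 / (6 * P) := by
          rw [le_div_iff₀ (by positivity)] at hPK ⊢
          linarith
      _ = ζ * P ^ 2 * ((ω / P) ^ 3 / 6) := by field_simp
      _ ≤ _ := by gcongr
  have hlin : γ * P ≤ γ * β := by gcongr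
  have hquad : 0 < χ * P ^ 2 := by positivity
  unfold F2
  linarith

theorem F2_add_neg {ω χ ζ C : ℝ} (hω : 0 < ω) (hχ : 0 < χ) (hζ : 0 < ζ) (hC : 0 < C) :
    F2 ω χ (ω * χ) (ω * χ * C) ζ (ω + C) < 0 := by
  have hterm : 0 < ζ * (ω + C) ^ 2 * Real.exp (ω / (ω + C)) := by positivity
  have hquad : 0 < χ * C ^ 2 := by positivity
  unfold F2
  linarith

/-- Case (ii): if `F₂(β) > 0`, where `β > 0` is the unique zero of `F₂'`, then there are
unique `0 < α₁ < β < α₂` with `F₂(α₁) = F₂(α₂) = 0`; moreover `F₂ < 0` on `(0, α₁)`,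
`F₂ > 0` on `(α₁, α₂)` and `F₂ < 0` on `(α₂, ∞)`. -/
theorem F2_two_zeros_of_F2_pos (ω χ ζ C γ μ : ℝ)
    (hω : 0 < ω) (hχ : 0 < χ) (hζ : 0 < ζ) (hC : 0 < C)
    (hγ : γ = ω * χ) (hμ : μ = γ * C)
    (β : ℝ) (hβ : 0 < β) (hβ0 : F2deriv ω χ γ ζ β = 0)
    (hβuniq : ∀ x : ℝ, 0 < x → F2deriv ω χ γ ζ x = 0 → x = β)
    (hpos : 0 < F2 ω χ γ μ ζ β) :
    ∃ α₁ α₂ : ℝ, 0 < α₁ ∧ α₁ < β ∧ β < α₂ ∧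
      F2 ω χ γ μ ζ α₁ = 0 ∧ F2 ω χ γ μ ζ α₂ = 0 ∧
      (∀ P, 0 < P → P < α₁ → F2 ω χ γ μ ζ P < 0) ∧
      (∀ P, α₁ < P → P < α₂ → 0 < F2 ω χ γ μ ζ P) ∧
      (∀ P, α₂ < P → F2 ω χ γ μ ζ P < 0) ∧
      (∀ x : ℝ, 0 < x → F2 ω χ γ μ ζ x = 0 → x = α₁ ∨ x = α₂) := by
  subst hμ hγ
  obtain rfl : ω / 2 = β := hβuniq _ (half_pos hω) (by rw [F2deriv_eq_mul]; ring)
  have hmono := F2_strictMonoOn (ω := ω) (ω * χ * C) hχ hζ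
  have hanti := F2_strictAntiOn (ω * χ * C) hω hχ hζ
  have hcont := F2_continuousOn ω χ (ω * χ) (ω * χ * C) ζ
  obtain ⟨p, hp, hpβ, hpneg⟩ := exists_F2_neg_le hω hχ (mul_pos hω hχ)
    (mul_pos (mul_pos hω hχ) hC) hζ hβ
  have hqneg := F2_add_neg hω hχ hζ hC
  obtain ⟨α₁, ⟨hpα, hαβ⟩, hα₁⟩ := intermediate_value_Ioo hpβ
    (hcont.mono fun x hx => hp.trans_le hx.1) ⟨hpneg, hpos⟩
  obtain ⟨α₂, ⟨hβα, -⟩, hα₂⟩ := intermediate_value_Ioo' (by linarith : ω / 2 ≤ ω + C)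
    (hcont.mono fun x hx => hβ.trans_le hx.1) ⟨hqneg, hpos⟩
  have hα₁0 : 0 < α₁ := hp.trans hpα
  have hleft : ∀ P, 0 < P → P < α₁ → F2 ω χ (ω * χ) (ω * χ * C) ζ P < 0 := fun P hP hPα =>
    hα₁ ▸ hmono ⟨hP, (hPα.trans hαβ).le⟩ ⟨hα₁0, hαβ.le⟩ hPα
  have hmid : ∀ P, α₁ < P → P < α₂ → 0 < F2 ω χ (ω * χ) (ω * χ * C) ζ P := by
    intro P h₁ h₂
    rcases le_total P (ω / 2) with h | h
    · exact hα₁ ▸ hmono ⟨hα₁0, hαβ.le⟩ ⟨hα₁0.trans h₁, h⟩ h₁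
    · exact hα₂ ▸ hanti h hβα.le h₂
  have hright : ∀ P, α₂ < P → F2 ω χ (ω * χ) (ω * χ * C) ζ P < 0 := fun P hP =>
    hα₂ ▸ hanti hβα.le (hβα.trans hP).le hP
  refine ⟨α₁, α₂, hα₁0, hαβ, hβα, hα₁, hα₂, hleft, hmid, hright, fun x hx hx0 => ?_⟩
  rcases lt_trichotomy x α₁ with h | h | h
  · exact absurd hx0 (hleft x hx h).ne
  · exact Or.inl h
  rcases lt_trichotomy x α₂ with h' | h' | h'
  · exact absurd hx0 (hmid x h h').ne'
  · exact Or.inr h'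
  · exact absurd hx0 (hright x h').ne
end

section
/- Fix real parameters ω > 0, χ > 0, ζ > 0, C > 0 and set γ = ωχ, μ = γC. Define η(P) = (χ e^{−ω/P} + ζ)/(P + C) and F₂(P) = −χP² + γP + μ − ζP²e^{ω/P} for P > 0. Suppose F₂(β) > 0, where β is the unique zero of F₂′(P) = −2χP + γ + ζ e^{ω/P}(ω − 2P), and let 0 < α₁ < β < α₂ be the two zeros of F₂. Then η is strictly decreasing on (0, α₁], strictly increasing on [α₁, α₂], and strictly decreasing on [α₂, ∞). -/
/-- Energy efficiency of one multicast group as a function of its transmit power `P`: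
`η(P) = (χ e^{-ω/P} + ζ)/(P + C)`. -/
noncomputable def eta (ω χ ζ C : ℝ) (P : ℝ) : ℝ :=
  (χ * Real.exp (-ω / P) + ζ) / (P + C)

theorem hasDerivAt_exp_div (a : ℝ) {P : ℝ} (hP : 0 < P) :
    HasDerivAt (fun x : ℝ => Real.exp (a / x)) (Real.exp (a / P) * (-a / P ^ 2)) P := by
  have h := ((hasDerivAt_const P a).div (hasDerivAt_id P) hP.ne').exp
  simpa using h

theorem hasDerivAt_F2 (ω χ γ μ ζ : ℝ) {P : ℝ} (hP : 0 < P) :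
    HasDerivAt (F2 ω χ γ μ ζ) (F2deriv ω χ γ ζ P) P := by
  have h := (((((hasDerivAt_id P).pow 2).const_mul (-χ)).add
    ((hasDerivAt_id P).const_mul γ)).add_const μ).sub
    ((((hasDerivAt_id P).pow 2).const_mul ζ).mul (hasDerivAt_exp_div ω hP))
  refine h.congr_deriv ?_
  simp only [F2deriv, id, Pi.pow_apply]
  field_simp
  ring

theorem hasDerivAt_F2deriv (ω χ γ ζ : ℝ) {P : ℝ} (hP : 0 < P) :
    HasDerivAt (F2deriv ω χ γ ζ)
      (-2 * χ - ζ * Real.exp (ω / P) * (P ^ 2 + (P - ω) ^ 2) / P ^ 2) P := by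
  have h := (((hasDerivAt_id P).const_mul (-2 * χ)).add_const γ).add
    (((hasDerivAt_exp_div ω hP).const_mul ζ).mul
      (((hasDerivAt_id P).const_mul 2).const_sub ω))
  refine h.congr_deriv ?_
  simp only [id]
  field_simp
  ring

theorem hasDerivAt_eta (ω χ ζ : ℝ) {C P : ℝ} (hC : 0 < C) (hP : 0 < P) :
    HasDerivAt (eta ω χ ζ C)
      (Real.exp (-ω / P) / (P ^ 2 * (P + C) ^ 2) * F2 ω χ (ω * χ) (ω * χ * C) ζ P) P := by
  have hPC : P + C ≠ 0 := by positivity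
  have h := (((hasDerivAt_exp_div (-ω) hP).const_mul χ).add_const ζ).div
    ((hasDerivAt_id P).add_const C) hPC
  refine h.congr_deriv ?_
  have hE : Real.exp (ω / P) = (Real.exp (-ω / P))⁻¹ := by
    rw [← Real.exp_neg, neg_div, neg_neg]
  have hne := Real.exp_ne_zero (-ω / P)
  simp only [F2, id, hE]
  generalize Real.exp (-ω / P) = E at hne ⊢
  field_simp
  ring

theorem strictAntiOn_F2deriv {ω χ ζ : ℝ} (γ : ℝ) (hχ : 0 < χ) (hζ : 0 < ζ) :
    StrictAntiOn (F2deriv ω χ γ ζ) (Set.Ioi 0) := by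
  refine strictAntiOn_of_deriv_neg (convex_Ioi 0)
    (fun x hx => (hasDerivAt_F2deriv ω χ γ ζ hx).continuousAt.continuousWithinAt) fun x hx => ?_
  rw [interior_Ioi] at hx
  have hx' : 0 < x := hx
  rw [(hasDerivAt_F2deriv ω χ γ ζ hx').deriv]
  have : 0 ≤ ζ * Real.exp (ω / x) * (x ^ 2 + (x - ω) ^ 2) / x ^ 2 := by positivity
  linarith

/-- If `F₂(β) > 0`, where `β` is the unique zero of `F₂'`, and `0 < α₁ < β < α₂` are the
two zeros of `F₂`, then `η` is strictly decreasing on `(0, α₁]`, strictly increasing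
on `[α₁, α₂]`, and strictly decreasing on `[α₂, ∞)`. -/
theorem eta_monotonicity_of_F2_pos (ω χ ζ C γ μ : ℝ)
    (hω : 0 < ω) (hχ : 0 < χ) (hζ : 0 < ζ) (hC : 0 < C)
    (hγ : γ = ω * χ) (hμ : μ = γ * C)
    (β : ℝ) (hβ : 0 < β) (hβ0 : F2deriv ω χ γ ζ β = 0)
    (hβuniq : ∀ x : ℝ, 0 < x → F2deriv ω χ γ ζ x = 0 → x = β)
    (hpos : 0 < F2 ω χ γ μ ζ β)
    (α₁ α₂ : ℝ) (hα₁ : 0 < α₁) (hα₁β : α₁ < β) (hβα₂ : β < α₂)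
    (hα₁0 : F2 ω χ γ μ ζ α₁ = 0) (hα₂0 : F2 ω χ γ μ ζ α₂ = 0) :
    StrictAntiOn (eta ω χ ζ C) (Set.Ioc 0 α₁) ∧
    StrictMonoOn (eta ω χ ζ C) (Set.Icc α₁ α₂) ∧
    StrictAntiOn (eta ω χ ζ C) (Set.Ici α₂) := by
  have hanti := strictAntiOn_F2deriv (ω := ω) γ hχ hζ
  have hα₂ : 0 < α₂ := hβ.trans hβα₂
  have hmono : StrictMonoOn (F2 ω χ γ μ ζ) (Set.Ioc 0 β) := by
    refine strictMonoOn_of_deriv_pos (convex_Ioc 0 β)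
      (fun x hx => (hasDerivAt_F2 ω χ γ μ ζ hx.1).continuousAt.continuousWithinAt) fun x hx => ?_
    rw [interior_Ioc] at hx
    rw [(hasDerivAt_F2 ω χ γ μ ζ hx.1).deriv, ← hβ0]
    exact hanti hx.1 hβ hx.2
  have hdecr : StrictAntiOn (F2 ω χ γ μ ζ) (Set.Ici β) := by
    refine strictAntiOn_of_deriv_neg (convex_Ici β)
      (fun x hx => (hasDerivAt_F2 ω χ γ μ ζ
        (hβ.trans_le hx)).continuousAt.continuousWithinAt) fun x hx => ?_
    rw [interior_Ici] at hx
    have hx0 : 0 < x := hβ.trans hx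
    rw [(hasDerivAt_F2 ω χ γ μ ζ hx0).deriv, ← hβ0]
    exact hanti hβ hx0 hx
  subst hγ hμ
  have hcont : ∀ x, 0 < x → ContinuousAt (eta ω χ ζ C) x := fun x hx =>
    (hasDerivAt_eta ω χ ζ hC hx).continuousAt
  have hfactor : ∀ x, 0 < x → 0 < Real.exp (-ω / x) / (x ^ 2 * (x + C) ^ 2) := fun x hx => by
    positivity
  refine ⟨?_, ?_, ?_⟩
  · refine strictAntiOn_of_deriv_neg (convex_Ioc 0 α₁)
      (fun x hx => (hcont x hx.1).continuousWithinAt) fun x hx => ?_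
    rw [interior_Ioc] at hx
    rw [(hasDerivAt_eta ω χ ζ hC hx.1).deriv]
    refine mul_neg_of_pos_of_neg (hfactor x hx.1) ?_
    rw [← hα₁0]
    exact hmono ⟨hx.1, (hx.2.trans hα₁β).le⟩ ⟨hα₁, hα₁β.le⟩ hx.2
  · refine strictMonoOn_of_deriv_pos (convex_Icc α₁ α₂)
      (fun x hx => (hcont x (hα₁.trans_le hx.1)).continuousWithinAt) fun x hx => ?_
    rw [interior_Icc] at hx
    have hx0 : 0 < x := hα₁.trans hx.1
    rw [(hasDerivAt_eta ω χ ζ hC hx0).deriv]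
    refine mul_pos (hfactor x hx0) ?_
    rcases le_total x β with h | h
    · rw [← hα₁0]
      exact hmono ⟨hα₁, hα₁β.le⟩ ⟨hx0, h⟩ hx.1
    · rw [← hα₂0]
      exact hdecr h hβα₂.le hx.2
  · refine strictAntiOn_of_deriv_neg (convex_Ici α₂)
      (fun x hx => (hcont x (hα₂.trans_le hx)).continuousWithinAt) fun x hx => ?_
    rw [interior_Ici] at hx
    have hx0 : 0 < x := hα₂.trans hx
    rw [(hasDerivAt_eta ω χ ζ hC hx0).deriv]
    refine mul_neg_of_pos_of_neg (hfactor x hx0) ?_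
    rw [← hα₂0]
    exact hdecr hβα₂.le (hβα₂.trans hx).le hx
end
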